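/- Let X be an infinite set (e.g. X = ℕ) and let B_X be the monoid of binary relations on X. No topology containing all the sets V_{X, Z} = {h ∈ B_X : im(h) ⊆ Z}, for Z ⊆ X, is second countable. In particular, if X is countable, choosing an antichain {X_i : i ∈ I} of 2^{ℵ₀} many subsets of X pairwise incomparable under inclusion, and relations f_i with im(f_i) = X_i, any basis of such a topology must have cardinality at least 2^{ℵ₀}. -/

import Mathlib

open Topology

/-- For an infinite set `X`, no topology on the monoid `B_X` of binary relations
on `X` containing all the sets `V_{X,Z} = {h : im(h) ⊆ Z}`, for `Z ⊆ X`, is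
second countable. -/
theorem stmt13 {X : Type*} [Infinite X] :
    ∀ 𝒯 : TopologicalSpace (Set (X × X)),
      (∀ Z : Set X, IsOpen[𝒯] {h : Set (X × X) | ∀ p ∈ h, p.2 ∈ Z}) →
      ¬ @SecondCountableTopology (Set (X × X)) 𝒯 := by
  intro 𝒯 hV hsc
  obtain ⟨b, hbc, -, hb⟩ := TopologicalSpace.exists_countable_basis (Set (X × X))
  have key : ∀ Z : Set X, ∃ U ∈ b, (Set.univ ×ˢ Z : Set (X × X)) ∈ U ∧
      U ⊆ {h : Set (X × X) | ∀ p ∈ h, p.2 ∈ Z} := fun Z =>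
    hb.exists_subset_of_mem_open (fun p hp => hp.2) (hV Z)
  choose U hUb hmem hsub using key
  have hle : ∀ Z W : Set X, U Z = U W → Z ⊆ W := by
    intro Z W h z hz
    have h1 : (Set.univ ×ˢ Z : Set (X × X)) ∈ U W := h ▸ hmem Z
    exact hsub W h1 (z, z) ⟨Set.mem_univ _, hz⟩
  have hinj : Function.Injective (fun Z : Set X => (⟨U Z, hUb Z⟩ : b)) := by
    intro Z W h
    have h' : U Z = U W := congrArg Subtype.val h
    exact Set.Subset.antisymm (hle Z W h') (hle W Z h'.symm)
  have : Countable b := hbc.to_subtype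
  have : Countable (Set X) := hinj.countable
  obtain ⟨g, hg⟩ := exists_injective_nat (Set X)
  exact Function.cantor_injective (fun Z => Infinite.natEmbedding X (g Z))
    ((Infinite.natEmbedding X).injective.comp hg)
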